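/- Projective Cliffords are automorphisms for the condensed product: every gamma in PCl' satisfies gamma(Delta_u star Delta_v) = gamma(Delta_u) star gamma(Delta_v) for all u, v in V', where star is the condensed product on P'. -/

import Mathlib

noncomputable section

namespace PaperPCl

/-- `d' = 2d` if `d` is even, `d' = d` if `d` is odd. -/
def dp (d : ℕ) : ℕ := if Even d then 2 * d else d

lemma d_dvd_dp (d : ℕ) : d ∣ dp d := by
  unfold dp; split
  · exact dvd_mul_left d 2
  · rfl

/-- The phase space `V = (ZMod d)^n × (ZMod d)^n`, vectors written `(q, p)`. -/
abbrev V (d n : ℕ) := (Fin n → ZMod d) × (Fin n → ZMod d)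

/-- Dot product of two vectors in `(ZMod d)^n`. -/
def dotp {d n : ℕ} (p q : Fin n → ZMod d) : ZMod d := ∑ i, p i * q i

/-- The standard symplectic form `omega((q1,p1),(q2,p2)) = p1·q2 - p2·q1`. -/
def omegaF {d n : ℕ} (v w : V d n) : ZMod d := dotp v.2 w.1 - dotp w.2 v.1

/-- Componentwise reduction mod `d`, `V' → V`. -/
def reduceV (d n : ℕ) (v : V (dp d) n) : V d n :=
  (fun i => ZMod.castHom (d_dvd_dp d) (ZMod d) (v.1 i),
   fun i => ZMod.castHom (d_dvd_dp d) (ZMod d) (v.2 i))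

/-- Componentwise `val`-lift `V → V'`. -/
def liftV (d n : ℕ) (u : V d n) : V (dp d) n :=
  (fun i => ((u.1 i).val : ZMod (dp d)), fun i => ((u.2 i).val : ZMod (dp d)))

/-- `zeta = exp(2 pi i / d)`. -/
def zeta (d : ℕ) : ℂ := Complex.exp (2 * Real.pi * Complex.I / d)

/-- `tau = exp(pi i / d)` if `d` is even, `tau = zeta^((d+1)/2)` if `d` is odd. -/
def tau (d : ℕ) : ℂ :=
  if Even d then Complex.exp (Real.pi * Complex.I / d) else zeta d ^ ((d + 1) / 2)

/-- The Pauli matrix `D_(q,p) = X^q Z^p`, a `d^n × d^n` complex matrix. -/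
def Dop (d n : ℕ) [NeZero d] (u : V d n) : Matrix (Fin n → ZMod d) (Fin n → ZMod d) ℂ :=
  fun r s => if r = s + u.1 then zeta d ^ (dotp u.2 s).val else 0

/-- The displacement operator `Delta_v = tau^(q·p) D_(vbar)` for `v = (q,p) ∈ V'`. -/
def Delta (d n : ℕ) [NeZero d] (v : V (dp d) n) : Matrix (Fin n → ZMod d) (Fin n → ZMod d) ℂ :=
  tau d ^ (dotp v.1 v.2).val • Dop d n (reduceV d n v)

/-- The large Pauli group `P'`: the subgroup of invertible `d^n × d^n` complex matrices
generated by the scalar matrix `tau • 1` together with all `D_u`, `u ∈ V`. -/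
def Pgrp (d n : ℕ) [NeZero d] : Subgroup (Matrix (Fin n → ZMod d) (Fin n → ZMod d) ℂ)ˣ :=
  Subgroup.closure {x | (x : Matrix (Fin n → ZMod d) (Fin n → ZMod d) ℂ)
      = tau d • (1 : Matrix (Fin n → ZMod d) (Fin n → ZMod d) ℂ)
    ∨ ∃ u : V d n, (x : Matrix (Fin n → ZMod d) (Fin n → ZMod d) ℂ) = Dop d n u}

/-- The underlying matrix of an element of `P'`. -/
def matVal {d n : ℕ} [NeZero d] (g : ↥(Pgrp d n)) : Matrix (Fin n → ZMod d) (Fin n → ZMod d) ℂ :=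
  ((g : (Matrix (Fin n → ZMod d) (Fin n → ZMod d) ℂ)ˣ) : Matrix (Fin n → ZMod d) (Fin n → ZMod d) ℂ)

/-- A function `γ : P' → P'` is center-respecting if `γ(z*g) = z*γ(g)`
for every `z` in the center of `P'`. -/
def CenterResp {d n : ℕ} [NeZero d] (γ : ↥(Pgrp d n) → ↥(Pgrp d n)) : Prop :=
  ∀ z ∈ Subgroup.center ↥(Pgrp d n), ∀ g, γ (z * g) = z * γ g

/-- A group automorphism of `P'` is projective Clifford if it fixes the center pointwise. -/
def IsPCl {d n : ℕ} [NeZero d] (γ : ↥(Pgrp d n) ≃* ↥(Pgrp d n)) : Prop :=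
  ∀ z ∈ Subgroup.center ↥(Pgrp d n), γ z = z

/-- A linear automorphism is symplectic if it preserves the standard symplectic form. -/
def IsSymp (d n : ℕ) (ψ : V d n ≃ₗ[ZMod d] V d n) : Prop :=
  ∀ u v : V d n, omegaF (ψ u) (ψ v) = omegaF u v

/-- `b` is a standard basis vector of `V`. -/
def IsStdBasis {d n : ℕ} (b : V d n) : Prop :=
  (∃ i : Fin n, b = (Pi.single i 1, 0)) ∨ (∃ i : Fin n, b = (0, Pi.single i 1))

lemma dotp_add_left {d n : ℕ} (p p' q : Fin n → ZMod d) :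
    dotp (p + p') q = dotp p q + dotp p' q := by
  simp [dotp, add_mul, Finset.sum_add_distrib]

lemma dotp_add_right {d n : ℕ} (p q q' : Fin n → ZMod d) :
    dotp p (q + q') = dotp p q + dotp p q' := by
  simp [dotp, mul_add, Finset.sum_add_distrib]

lemma isPrimitiveRoot_zeta (d : ℕ) [NeZero d] : IsPrimitiveRoot (zeta d) d :=
  Complex.isPrimitiveRoot_exp d (NeZero.ne d)

lemma zeta_pow_val_add {d : ℕ} [NeZero d] (x y : ZMod d) :
    zeta d ^ (x + y).val = zeta d ^ x.val * zeta d ^ y.val := by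
  rw [ZMod.val_add, ← pow_add, ← pow_mod_orderOf _ (x.val + y.val),
    ← (isPrimitiveRoot_zeta d).eq_orderOf]

lemma zeta_pow_val_injective (d : ℕ) [NeZero d] :
    Function.Injective fun x : ZMod d => zeta d ^ x.val := fun x y h =>
  ZMod.val_injective d ((isPrimitiveRoot_zeta d).pow_inj (ZMod.val_lt x) (ZMod.val_lt y) h)

lemma Dop_mul_Dop {d n : ℕ} [NeZero d] (u v : V d n) :
    Dop d n u * Dop d n v = zeta d ^ (dotp u.2 v.1).val • Dop d n (u + v) := by
  ext r s
  simp only [Matrix.mul_apply, Matrix.smul_apply, Dop, smul_eq_mul, mul_ite, mul_zero,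
    Finset.sum_ite_eq', Finset.mem_univ, if_true, ite_mul, zero_mul,
    Prod.fst_add, Prod.snd_add]
  rw [show s + v.1 + u.1 = s + (u.1 + v.1) by abel]
  split_ifs
  · rw [dotp_add_right, dotp_add_left, zeta_pow_val_add, zeta_pow_val_add]
    ring
  · rfl

lemma Dop_mul_comm {d n : ℕ} [NeZero d] (u v : V d n) :
    Dop d n u * Dop d n v = zeta d ^ (omegaF u v).val • (Dop d n v * Dop d n u) := by
  rw [Dop_mul_Dop, Dop_mul_Dop, smul_smul, ← zeta_pow_val_add, add_comm v u, omegaF,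
    sub_add_cancel]

lemma Delta_mul_comm {d n : ℕ} [NeZero d] (u v : V (dp d) n) :
    Delta d n u * Delta d n v =
      zeta d ^ (omegaF (reduceV d n u) (reduceV d n v)).val • (Delta d n v * Delta d n u) := by
  simp only [Delta, smul_mul_assoc, mul_smul_comm]
  rw [Dop_mul_comm (reduceV d n u)]
  simp only [smul_smul]
  congr 1
  ring

lemma reduceV_liftV {d n : ℕ} [NeZero d] (a : V d n) : reduceV d n (liftV d n a) = a := by
  ext i <;> simp [reduceV, liftV]

lemma matVal_mul {d n : ℕ} [NeZero d] (g h : ↥(Pgrp d n)) :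
    matVal (g * h) = matVal g * matVal h := rfl

lemma matVal_injective (d n : ℕ) [NeZero d] :
    Function.Injective (matVal : ↥(Pgrp d n) → _) := fun _ _ h =>
  Subtype.ext (Units.ext h)

lemma matVal_ne_zero {d n : ℕ} [NeZero d] (g : ↥(Pgrp d n)) : matVal g ≠ 0 :=
  Units.ne_zero _

lemma mem_center_of_matVal_eq_smul_one {d n : ℕ} [NeZero d] {z : ↥(Pgrp d n)} {c : ℂ}
    (hz : matVal z = c • 1) : z ∈ Subgroup.center ↥(Pgrp d n) := by
  refine Subgroup.mem_center_iff.mpr fun g => matVal_injective d n ?_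
  simp [matVal_mul, hz]

/-- A projective Clifford automorphism preserves scalar relations between elements of `P'`. -/
lemma IsPCl.matVal_eq_smul {d n : ℕ} [NeZero d] {γ : ↥(Pgrp d n) ≃* ↥(Pgrp d n)}
    (hγ : IsPCl γ) {x y : ↥(Pgrp d n)} {c : ℂ} (h : matVal x = c • matVal y) :
    matVal (γ x) = c • matVal (γ y) := by
  have hz : matVal (x * y⁻¹) = c • 1 := by
    rw [matVal_mul, h, smul_mul_assoc, ← matVal_mul, mul_inv_cancel]
    rfl
  have hx : γ x = x * y⁻¹ * γ y := by
    rw [← hγ _ (mem_center_of_matVal_eq_smul_one hz), ← map_mul, inv_mul_cancel_right]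
  rw [hx, matVal_mul, hz, smul_mul_assoc, one_mul]

theorem condensed_product_automorphism (d n : ℕ) [NeZero d] (hd : 2 ≤ d) (hn : 1 ≤ n)
    (γ : ↥(Pgrp d n) ≃* ↥(Pgrp d n)) (hγ : IsPCl γ)
    (u v : V (dp d) n) (gu gv guv : ↥(Pgrp d n))
    (hu : matVal gu = Delta d n u) (hv : matVal gv = Delta d n v)
    (huv : matVal guv =
      (tau d)⁻¹ ^ (omegaF (reduceV d n u) (reduceV d n v)).val • (Delta d n u * Delta d n v))
    (a b : V d n) (s t : ZMod (dp d))
    (ha : matVal (γ gu) = tau d ^ s.val • Delta d n (liftV d n a))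
    (hb : matVal (γ gv) = tau d ^ t.val • Delta d n (liftV d n b)) :
    matVal (γ guv) = (tau d)⁻¹ ^ (omegaF a b).val • (matVal (γ gu) * matVal (γ gv)) := by
  have hγcomm : matVal (γ gu) * matVal (γ gv) =
      zeta d ^ (omegaF (reduceV d n u) (reduceV d n v)).val •
        (matVal (γ gv) * matVal (γ gu)) := by
    have h : matVal (gu * gv) = zeta d ^ (omegaF (reduceV d n u) (reduceV d n v)).val •
        matVal (gv * gu) := by
      rw [matVal_mul, matVal_mul, hu, hv, Delta_mul_comm]
    simpa only [map_mul, matVal_mul] using hγ.matVal_eq_smul h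
  have habcomm : matVal (γ gu) * matVal (γ gv) =
      zeta d ^ (omegaF a b).val • (matVal (γ gv) * matVal (γ gu)) := by
    simp only [ha, hb, smul_mul_assoc, mul_smul_comm]
    rw [Delta_mul_comm (liftV d n a), reduceV_liftV, reduceV_liftV]
    simp only [smul_smul]
    congr 1
    ring
  have homega : omegaF (reduceV d n u) (reduceV d n v) = omegaF a b :=
    zeta_pow_val_injective d <| smul_left_injective ℂ (matVal_ne_zero (γ gv * γ gu)) <|
      hγcomm.symm.trans habcomm
  rw [← hu, ← hv, ← matVal_mul, homega] at huv
  rw [← matVal_mul, ← map_mul]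
  exact hγ.matVal_eq_smul huv

end PaperPCl
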